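/- arXiv:1703.05317 — 10 statements merged into one kernel-verified Lean document; each statement's English description precedes it below -/
import Mathlib

section
/- (Soundness of the refinement-testing error report, safety part of Theorem 1.) Suppose the labeling function L_A of the abstract system is injective. If there exist states s, u ∈ S_C with s →_C u such that: (i) there is no v ∈ S_A with r(s) →_A v and v = r(u); (ii) r(u) ≠ r(s); and (iii) there is no v ∈ S_A with r(s) →_A v and v = r(s); then M_C is not a WEB refinement of M_A with respect to r. -/
/-- A transition system: a transition relation and a labeling function. -/
structure TS (S : Type) (Λ : Type) where
  tr : S → S → Prop
  L : S → Λ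

/-- `B` is a well-founded equivalence bisimulation (WEB) on the TS `M`. -/
def isWEB {S Λ : Type} (M : TS S Λ) (B : S → S → Prop) : Prop :=
  Equivalence B ∧
  (∀ s w, B s w → M.L s = M.L w) ∧
  ∃ (W : Type) (prec : W → W → Prop), WellFounded prec ∧
    ∃ (rankt : S → W) (rankl : S → S → ℕ),
      ∀ s u w, B s w → M.tr s u →
        ((∃ v, M.tr w v ∧ B u v) ∨
         (B u w ∧ prec (rankt u) (rankt s)) ∨
         (∃ v, M.tr w v ∧ B s v ∧ rankl v s < rankl w s))

/-- The disjoint-union TS of a concrete system `MC` and an abstract system `MA`,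
with labeling given via the refinement map `r` on concrete states. -/
def duTS {SC SA Λ : Type} (MC : TS SC Λ) (MA : TS SA Λ) (r : SC → SA) :
    TS (SC ⊕ SA) Λ where
  tr x y :=
    match x, y with
    | Sum.inl s, Sum.inl u => MC.tr s u
    | Sum.inr s, Sum.inr u => MA.tr s u
    | _, _ => False
  L x :=
    match x with
    | Sum.inl s => MA.L (r s)
    | Sum.inr s => MA.L s

/-- `MC` is a WEB refinement of `MA` with respect to the refinement map `r`. -/
def WEBrefines {SC SA Λ : Type} (MC : TS SC Λ) (MA : TS SA Λ) (r : SC → SA) : Prop :=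
  ∃ B : (SC ⊕ SA) → (SC ⊕ SA) → Prop,
    (∀ s : SC, B (Sum.inl s) (Sum.inr (r s))) ∧ isWEB (duTS MC MA r) B

/-- `ρ`: map both components of the disjoint union into abstract states. -/
def rho {SC SA : Type} (r : SC → SA) : SC ⊕ SA → SA
  | Sum.inl s => r s
  | Sum.inr s => s

/-- soundness of the refinement-testing error report (safety part).
If `L_A` is injective and there is a concrete transition `s →_C u` such that `u`
cannot be matched by a step of the abstract system, `u` does not stutter
(`r u ≠ r s`), and the abstract state `r s` has no self-matching step, then
`M_C` is not a WEB refinement of `M_A` with respect to `r`. -/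
theorem stmt1 {SC SA Λ : Type} (MC : TS SC Λ) (MA : TS SA Λ) (r : SC → SA)
    (hinj : Function.Injective MA.L)
    (s u : SC) (hstep : MC.tr s u)
    (h1 : ¬ ∃ v : SA, MA.tr (r s) v ∧ v = r u)
    (h2 : r u ≠ r s)
    (h3 : ¬ ∃ v : SA, MA.tr (r s) v ∧ v = r s) :
    ¬ WEBrefines MC MA r := by
  rintro ⟨B, hr, -, hL, W, prec, -, rankt, rankl, hB⟩
  have rho_eq : ∀ x y, B x y → rho r x = rho r y := by
    intro x y hxy
    apply hinj
    have := hL x y hxy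
    cases x <;> cases y <;> exact this
  rcases hB (Sum.inl s) (Sum.inl u) (Sum.inr (r s)) (hr s) hstep with
    ⟨v, hv, huv⟩ | ⟨hus, -⟩ | ⟨v, hv, hsv, -⟩
  · cases v with
    | inl v => exact hv
    | inr v => exact h1 ⟨v, hv, (rho_eq _ _ huv).symm⟩
  · exact h2 (rho_eq _ _ hus)
  · cases v with
    | inl v => exact hv
    | inr v => exact h3 ⟨v, hv, (rho_eq _ _ hsv).symm⟩
end

section
/- (Soundness of the refinement-testing error report relative to a given rank function, Theorem 1.) Suppose the labeling function L_A is injective and the abstract system never stutters, i.e., there is no w ∈ S_A with w →_A w. Fix a well-founded order ⟨W, ≺⟩ and a function rankt₀ : S_C → W. If there exist states s, u ∈ S_C with s →_C u such that there is no v ∈ S_A with r(s) →_A v and v = r(u), and it is not the case that both r(u) = r(s) and rankt₀(u) ≺ rankt₀(s), then there are no B, rankl, and extension rankt : S_C ⊎ S_A → W of rankt₀ such that (B, rankt, rankl) witnesses the WEB refinement of M_A by M_C with respect to r. -/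
/-- A triple `(B, rankt, rankl)` over the well-founded order `prec` on `W`
witnesses the WEB refinement of `MA` by `MC` with respect to `r`. -/
def witnessesWEBRefinement {SC SA Λ W : Type} (MC : TS SC Λ) (MA : TS SA Λ)
    (r : SC → SA) (prec : W → W → Prop)
    (B : (SC ⊕ SA) → (SC ⊕ SA) → Prop)
    (rankt : SC ⊕ SA → W) (rankl : (SC ⊕ SA) → (SC ⊕ SA) → ℕ) : Prop :=
  Equivalence B ∧
  (∀ s : SC, B (Sum.inl s) (Sum.inr (r s))) ∧
  (∀ x y, B x y → (duTS MC MA r).L x = (duTS MC MA r).L y) ∧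
  (∀ s u w, B s w → (duTS MC MA r).tr s u →
    ((∃ v, (duTS MC MA r).tr w v ∧ B u v) ∨
     (B u w ∧ prec (rankt u) (rankt s)) ∨
     (∃ v, (duTS MC MA r).tr w v ∧ B s v ∧ rankl v s < rankl w s)))

/-- soundness of the refinement-testing error report relative to a
given rank function. -/
theorem stmt2 {SC SA Λ W : Type} (MC : TS SC Λ) (MA : TS SA Λ) (r : SC → SA)
    (hinj : Function.Injective MA.L)
    (hnostutter : ¬ ∃ w : SA, MA.tr w w)
    (prec : W → W → Prop) (hwf : WellFounded prec)
    (rankt₀ : SC → W)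
    (s u : SC) (hstep : MC.tr s u)
    (h1 : ¬ ∃ v : SA, MA.tr (r s) v ∧ v = r u)
    (h2 : ¬ (r u = r s ∧ prec (rankt₀ u) (rankt₀ s))) :
    ¬ ∃ (B : (SC ⊕ SA) → (SC ⊕ SA) → Prop)
        (rankt : SC ⊕ SA → W) (rankl : (SC ⊕ SA) → (SC ⊕ SA) → ℕ),
        (∀ c : SC, rankt (Sum.inl c) = rankt₀ c) ∧
        witnessesWEBRefinement MC MA r prec B rankt rankl := by
  rintro ⟨B, rankt, rankl, hext, -, hr, hL, hsim⟩
  rcases hsim _ (Sum.inl u) _ (hr s) hstep with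
    ⟨v | v, hv, huv⟩ | ⟨hu, hlt⟩ | ⟨v | v, hv, hsv, -⟩
  · exact hv
  · exact h1 ⟨v, hv, (hinj (hL _ _ huv)).symm⟩
  · exact h2 ⟨hinj (hL _ _ hu), by simpa only [hext] using hlt⟩
  · exact hv
  · obtain rfl : r s = v := hinj (hL _ _ hsv)
    exact hnostutter ⟨_, hv⟩
end

section
/- (Soundness of the simplified WEB refinement conjecture for deterministic machines.) Suppose the labeling function L_A is injective, →_C is the graph of a step function c : S_C → S_C, and →_A is the graph of a step function a : S_A → S_A. If there exists a function rankt : S_C → ℕ such that for every s ∈ S_C, either a(r(s)) = r(c(s)), or both r(s) = r(c(s)) and rankt(c(s)) < rankt(s), then M_C is a WEB refinement of M_A with respect to r; moreover, the relation B_r := {(x, y) ∈ (S_C ⊎ S_A)² : ρ(x) = ρ(y)} is a WEB on the disjoint-union TS witnessing this refinement. -/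
/-- The disjoint union of two deterministic systems is deterministic. -/
theorem duTS_tr_iff {SC SA Λ : Type} (MC : TS SC Λ) (MA : TS SA Λ) (r : SC → SA)
    {c : SC → SC} (hc : ∀ s u, MC.tr s u ↔ u = c s)
    {a : SA → SA} (ha : ∀ w v, MA.tr w v ↔ v = a w) (x y : SC ⊕ SA) :
    (duTS MC MA r).tr x y ↔ y = Sum.map c a x := by
  cases x <;> cases y <;> simp [duTS, hc, ha]

theorem duTS_L {SC SA Λ : Type} (MC : TS SC Λ) (MA : TS SA Λ) (r : SC → SA) (x : SC ⊕ SA) :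
    (duTS MC MA r).L x = MA.L (rho r x) := by
  cases x <;> rfl

theorem isWEB_rho {SC SA Λ : Type} (MC : TS SC Λ) (MA : TS SA Λ) (r : SC → SA)
    {c : SC → SC} (hc : ∀ s u, MC.tr s u ↔ u = c s)
    {a : SA → SA} (ha : ∀ w v, MA.tr w v ↔ v = a w) (rankt : SC → ℕ)
    (hrank : ∀ s, a (r s) = r (c s) ∨ (r s = r (c s) ∧ rankt (c s) < rankt s)) :
    isWEB (duTS MC MA r) (fun x y => rho r x = rho r y) := by
  let rank : SC ⊕ SA → ℕ := Sum.elim rankt fun _ => 0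
  have hstep : ∀ x, rho r (Sum.map c a x) = a (rho r x) ∨
      (rho r (Sum.map c a x) = rho r x ∧ rank (Sum.map c a x) < rank x) := by
    rintro (s | s)
    · exact (hrank s).imp Eq.symm fun h => ⟨h.1.symm, h.2⟩
    · exact Or.inl rfl
  refine ⟨⟨fun _ => rfl, Eq.symm, Eq.trans⟩, fun s w h => ?_,
    ℕ, (· < ·), wellFounded_lt, rank, fun w _ => rank w, fun s u w h hu => ?_⟩
  · rw [duTS_L, duTS_L, h]
  · simp only [duTS_tr_iff MC MA r hc ha] at hu ⊢
    subst hu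
    rcases hstep s with hs | ⟨hs, hlt⟩
    · rcases hstep w with hw | ⟨hw, hlt⟩
      · exact Or.inl ⟨_, rfl, by rw [hs, hw, h]⟩
      · exact Or.inr (Or.inr ⟨_, rfl, h.trans hw.symm, hlt⟩)
    · exact Or.inr (Or.inl ⟨hs.trans h, hlt⟩)

/-- soundness of the simplified WEB refinement conjecture for
deterministic machines. -/
theorem stmt3 {SC SA Λ : Type} (MC : TS SC Λ) (MA : TS SA Λ) (r : SC → SA)
    (hinj : Function.Injective MA.L)
    (c : SC → SC) (hc : ∀ s u, MC.tr s u ↔ u = c s)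
    (a : SA → SA) (ha : ∀ w v, MA.tr w v ↔ v = a w)
    (hcheck : ∃ rankt : SC → ℕ, ∀ s : SC,
      a (r s) = r (c s) ∨ (r s = r (c s) ∧ rankt (c s) < rankt s)) :
    WEBrefines MC MA r ∧
    ((∀ s : SC, rho r (Sum.inl s) = rho r (Sum.inr (r s))) ∧
      isWEB (duTS MC MA r) (fun x y => rho r x = rho r y)) := by
  obtain ⟨rankt, hrank⟩ := hcheck
  have hB := isWEB_rho MC MA r hc ha rankt hrank
  exact ⟨⟨_, fun _ => rfl, hB⟩, fun _ => rfl, hB⟩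
end

section
/- (Completeness of the simplified WEB refinement conjecture for deterministic machines, with ranks in ℕ.) Suppose the labeling function L_A is injective, →_C is the graph of a step function c : S_C → S_C, →_A is the graph of a step function a : S_A → S_A, and the abstract system never stutters, i.e., a(w) ≠ w for all w ∈ S_A. If M_C is a WEB refinement of M_A with respect to r, then there exists a function rankt : S_C → ℕ such that for every s ∈ S_C, either a(r(s)) = r(c(s)), or both r(s) = r(c(s)) and rankt(c(s)) < rankt(s). -/
/-- If every state outside `P` steps to a smaller one in a well-founded order, then the number of
steps needed to reach `P` is a natural-valued rank that decreases outside `P`. -/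
theorem exists_nat_rank_of_wellFounded {S W : Type*} {prec : W → W → Prop}
    (hwf : WellFounded prec) (f : S → S) (rk : S → W) (P : S → Prop)
    (h : ∀ s, ¬ P s → prec (rk (f s)) (rk s)) :
    ∃ rank : S → ℕ, ∀ s, ¬ P s → rank (f s) < rank s := by
  classical
  have hex : ∀ s, ∃ n, P (f^[n] s) := by
    intro s
    induction s using (InvImage.wf rk hwf).induction with
    | _ s ih =>
      by_cases hs : P s
      · exact ⟨0, hs⟩
      · obtain ⟨n, hn⟩ := ih (f s) (h s hs)
        exact ⟨n + 1, hn⟩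
  refine ⟨fun s => Nat.find (hex s), fun s hs => ?_⟩
  exact Nat.lt_of_succ_le (Nat.find_comp_succ (hex s) (hex (f s)) hs).ge

/-- completeness of the simplified WEB refinement conjecture for
deterministic machines with a non-stuttering abstract system, ranks in ℕ. -/
theorem stmt4 {SC SA Λ : Type} (MC : TS SC Λ) (MA : TS SA Λ) (r : SC → SA)
    (hinj : Function.Injective MA.L)
    (c : SC → SC) (hc : ∀ s u, MC.tr s u ↔ u = c s)
    (a : SA → SA) (ha : ∀ w v, MA.tr w v ↔ v = a w)
    (hnostutter : ∀ w : SA, a w ≠ w)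
    (href : WEBrefines MC MA r) :
    ∃ rankt : SC → ℕ, ∀ s : SC,
      a (r s) = r (c s) ∨ (r s = r (c s) ∧ rankt (c s) < rankt s) := by
  obtain ⟨B, hBr, -, hlab, W, prec, hwf, rk, rankl, hB⟩ := href
  have hmatch : ∀ s, ¬ a (r s) = r (c s) →
      r s = r (c s) ∧ prec (rk (Sum.inl (c s))) (rk (Sum.inl s)) := by
    intro s hs
    rcases hB (Sum.inl s) (Sum.inl (c s)) (Sum.inr (r s)) (hBr s) ((hc s _).2 rfl) with
      ⟨v | v, hv, hb⟩ | ⟨hb, hlt⟩ | ⟨v | v, hv, hb, -⟩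
    · exact hv.elim
    · obtain rfl := (ha _ _).1 hv
      exact absurd (hinj (hlab _ _ hb)).symm hs
    · exact ⟨(hinj (hlab _ _ hb)).symm, hlt⟩
    · exact hv.elim
    · obtain rfl := (ha _ _).1 hv
      exact absurd (hinj (hlab _ _ hb)).symm (hnostutter _)
  obtain ⟨rank, hrank⟩ := exists_nat_rank_of_wellFounded hwf c (fun s => rk (Sum.inl s))
    (fun s => a (r s) = r (c s)) fun s hs => (hmatch s hs).2
  exact ⟨rank, fun s => or_iff_not_imp_left.2 fun hs => ⟨(hmatch s hs).1, hrank s hs⟩⟩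
end

section
/- (For deterministic machines the well-founded structure ⟨ℕ, <⟩ always suffices.) Let M = ⟨S, →, L⟩ be a TS whose transition relation → is the graph of a function step : S → S. If B is a WEB on M (witnessed by some well-founded order ⟨W, ≺⟩ and rank functions rankt : S → W and rankl : S × S → ℕ), then B is a WEB on M witnessed by rank functions into the natural numbers: there exist rankt' : S → ℕ and rankl' : S × S → ℕ satisfying condition (3) of the WEB definition with the order < on ℕ. -/
/-- The number of steps before the orbit of `s` first leaves the `B`-class of `s`
(`0` if it never does). -/
noncomputable def exitTime {S : Type} (step : S → S) (B : S → S → Prop) (s : S) : ℕ :=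
  sInf {n | ¬ B s (step^[n] s)}

theorem exitTime_step_lt {S : Type} {step : S → S} {B : S → S → Prop} (hB : Equivalence B)
    {s : S} (hs : B s (step s)) (hexit : ∃ n, ¬ B s (step^[n] s)) :
    exitTime step B (step s) < exitTime step B s := by
  have hmem : ¬ B s (step^[exitTime step B s] s) := Nat.sInf_mem hexit
  rcases hk : exitTime step B s with _ | k
  · rw [hk] at hmem
    exact absurd (hB.refl s) hmem
  · rw [hk, Function.iterate_succ_apply] at hmem
    exact Nat.lt_succ_of_le (Nat.sInf_le fun h => hmem (hB.trans hs h))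

/-- for deterministic machines, the well-founded structure
`⟨ℕ, <⟩` always suffices: any WEB is witnessed by rank functions into ℕ. -/
theorem stmt5 {S Λ : Type} (M : TS S Λ) (step : S → S)
    (hdet : ∀ s u, M.tr s u ↔ u = step s)
    (B : S → S → Prop) (hB : isWEB M B) :
    ∃ (rankt' : S → ℕ) (rankl' : S → S → ℕ),
      ∀ s u w, B s w → M.tr s u →
        ((∃ v, M.tr w v ∧ B u v) ∨
         (B u w ∧ rankt' u < rankt' s) ∨
         (∃ v, M.tr w v ∧ B s v ∧ rankl' v s < rankl' w s)) := by
  obtain ⟨heq, -, W, prec, hwf, rankt, rankl, h⟩ := hB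
  have h_step : ∀ s w, B s w → B (step s) (step w) ∨
      (B (step s) w ∧ prec (rankt (step s)) (rankt s)) ∨
      (B s (step w) ∧ rankl (step w) s < rankl w s) := by
    intro s w hsw
    simpa [hdet] using h s (step s) w hsw ((hdet _ _).2 rfl)
  refine ⟨exitTime step B, fun x _ => exitTime step B x, fun s u w hsw htr => ?_⟩
  obtain rfl := (hdet _ _).1 htr
  simp only [hdet, exists_eq_left]
  by_cases huv : B (step s) (step w)
  · exact Or.inl huv
  rcases h_step s w hsw with h' | ⟨huw, -⟩ | ⟨hsv, -⟩
  · exact absurd h' huv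
  · refine Or.inr (Or.inl ⟨huw, exitTime_step_lt heq (heq.trans hsw (heq.symm huw)) ?_⟩)
    by_contra! hstay
    have hv : ∀ x, B s x → ¬ B x (step w) := fun x hx hxv =>
      huv (heq.trans huw (heq.trans (heq.symm hsw) (heq.trans hx hxv)))
    refine (wellFounded_iff_isEmpty_descending_chain.1 hwf).false
      ⟨fun n => rankt (step^[n] s), fun n => ?_⟩
    simp only [Function.iterate_succ_apply']
    rcases h_step (step^[n] s) w (heq.trans (heq.symm (hstay n)) hsw) with h' | h' | h'
    · rw [← Function.iterate_succ_apply' step] at h'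
      exact absurd h' (hv _ (hstay _))
    · exact h'.2
    · exact absurd h'.1 (hv _ (hstay n))
  · refine Or.inr (Or.inr ⟨hsv, exitTime_step_lt heq (heq.trans (heq.symm hsw) hsv) ?_⟩)
    by_contra! hstay
    have hu : ∀ x, B w x → ¬ B (step s) x := fun x hx hux =>
      huv (heq.trans hux (heq.trans (heq.symm hx) (heq.trans (heq.symm hsw) hsv)))
    refine (wellFounded_iff_isEmpty_descending_chain.1 (wellFounded_lt (α := ℕ))).false
      ⟨fun n => rankl (step^[n] w) s, fun n => ?_⟩
    simp only [Function.iterate_succ_apply']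
    rcases h_step s (step^[n] w) (heq.trans hsw (hstay n)) with h' | h' | h'
    · rw [← Function.iterate_succ_apply' step] at h'
      exact absurd h' (hu _ (hstay _))
    · exact absurd h'.1 (hu _ (hstay n))
    · exact h'.2
end

section
/- (Single-step matching lemma for WEBs.) Let B be a WEB on a TS ⟨S, →, L⟩. If s B w and s → u, then there exist m ≥ 0 and states v₀, v₁, …, v_m with v₀ = w, v_i → v_{i+1} for all i < m, s B v_i for all i < m, and u B v_m. -/
/-- single-step matching lemma for WEBs. -/
theorem stmt7 {S Λ : Type} (M : TS S Λ) (B : S → S → Prop) (hB : isWEB M B)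
    (s u w : S) (hsw : B s w) (hsu : M.tr s u) :
    ∃ (m : ℕ) (v : ℕ → S), v 0 = w ∧
      (∀ i < m, M.tr (v i) (v (i + 1))) ∧
      (∀ i < m, B s (v i)) ∧
      B u (v m) := by
  obtain ⟨_, _, W, prec, _, rankt, rankl, h⟩ := hB
  induction hn : rankl w s using Nat.strong_induction_on generalizing w with
  | _ n ih =>
    rcases h s u w hsw hsu with ⟨x, hwx, hux⟩ | ⟨huw, _⟩ | ⟨x, hwx, hsx, hlt⟩
    · refine ⟨1, fun i => if i = 0 then w else x, rfl, ?_, ?_, hux⟩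
      · intro i hi
        obtain rfl : i = 0 := by omega
        exact hwx
      · intro i hi
        obtain rfl : i = 0 := by omega
        exact hsw
    · exact ⟨0, fun _ => w, rfl, by simp, by simp, huw⟩
    · obtain ⟨m, v, hv0, htr, hsv, huv⟩ := ih _ (hn ▸ hlt) x hsx rfl
      refine ⟨m + 1, fun i => i.casesOn w v, rfl, ?_, ?_, huv⟩
      · rintro (_ | i) hi
        · exact hv0.symm.subst (motive := M.tr w) hwx
        · exact htr i (by omega)
      · rintro (_ | i) hi
        · exact hsw
        · exact hsv i (by omega)
end

section
/- (States related by a WEB have identical behaviors up to finite stuttering.) Let B be a WEB on a TS ⟨S, →, L⟩, let s B w, and let σ : ℕ → S be a fullpath from s, i.e., σ(0) = s and σ(i) → σ(i+1) for all i ∈ ℕ. Then there exist a fullpath δ : ℕ → S with δ(0) = w and δ(j) → δ(j+1) for all j ∈ ℕ, and strictly increasing functions π, ξ : ℕ → ℕ with π(0) = ξ(0) = 0, such that for every i ∈ ℕ, every j with π(i) ≤ j < π(i+1), and every k with ξ(i) ≤ k < ξ(i+1), we have σ(j) B δ(k). -/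
/-- Every natural number lies in one of the blocks delimited by a strictly increasing sequence
starting at `0`. -/
theorem StrictMono.exists_mem_block {ξ : ℕ → ℕ} (hξ : StrictMono ξ) (hξ0 : ξ 0 = 0) (k : ℕ) :
    ∃ i, ξ i ≤ k ∧ k < ξ (i + 1) := by
  induction k with
  | zero => exact ⟨0, hξ0.le, hξ0.symm.trans_lt (hξ Nat.zero_lt_one)⟩
  | succ k ih =>
    obtain ⟨i, h1, h2⟩ := ih
    rcases (Nat.succ_le_of_lt h2).eq_or_lt with h | h
    · exact ⟨i + 1, h.ge, h.trans_lt (hξ (Nat.lt_succ_self _))⟩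
    · exact ⟨i, by omega, h⟩

/-- From a `B`-related pair one can match a nonempty finite block of `σ` with a nonempty finite
path, ending in a `B`-related pair again. -/
theorem isWEB.exists_matching_block {S Λ : Type} {M : TS S Λ} {B : S → S → Prop}
    (hB : isWEB M B) {σ : ℕ → S} (hσ : ∀ i, M.tr (σ i) (σ (i + 1))) (n : ℕ) (w : S)
    (h : B (σ n) w) :
    ∃ (n' m : ℕ) (p : ℕ → S), n < n' ∧ 0 < m ∧ p 0 = w ∧ (∀ i < m, M.tr (p i) (p (i + 1))) ∧
      (∀ j, n ≤ j → j < n' → ∀ k < m, B (σ j) (p k)) ∧ B (σ n') (p m) := by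
  obtain ⟨hE, -, W, prec, wf, rankt, rankl, hstep⟩ := hB
  suffices H : ∀ (x : W) (r n : ℕ) (w : S), rankt (σ n) = x → rankl w (σ n) = r → B (σ n) w →
      ∃ (n' m : ℕ) (p : ℕ → S), n < n' ∧ 0 < m ∧ p 0 = w ∧
        (∀ i < m, M.tr (p i) (p (i + 1))) ∧
        (∀ j, n ≤ j → j < n' → ∀ k < m, B (σ j) (p k)) ∧ B (σ n') (p m) from
    H _ _ n w rfl rfl h
  intro x
  induction x using wf.induction with
  | _ x ihx =>
  intro r
  induction r using Nat.strong_induction_on with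
  | _ r ihr =>
  intro n w hx hr h
  rcases hstep _ _ _ h (hσ n) with ⟨v, hv, huv⟩ | ⟨huw, hlt⟩ | ⟨v, hv, hsv, hlt⟩
  · refine ⟨n + 1, 1, fun i => if i = 0 then w else v, by omega, by omega, rfl, ?_, ?_, by simpa⟩
    · intro i hi
      obtain rfl : i = 0 := by omega
      simpa using hv
    · intro j hj hj' k hk
      obtain rfl : k = 0 := by omega
      obtain rfl : j = n := by omega
      simpa using h
  · obtain ⟨n', m, p, hn, hm, hp0, hp, hpB, hend⟩ :=
      ihx _ (hx ▸ hlt) _ (n + 1) w rfl rfl huw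
    refine ⟨n', m, p, by omega, hm, hp0, hp, ?_, hend⟩
    intro j hj hj' k hk
    rcases hj.eq_or_lt with rfl | hj
    · exact hE.trans h (hE.trans (hE.symm huw) (hpB (n + 1) le_rfl hn k hk))
    · exact hpB j hj hj' k hk
  · obtain ⟨n', m, p, hn, hm, hp0, hp, hpB, hend⟩ := ihr _ (hr ▸ hlt) n v hx rfl hsv
    refine ⟨n', m + 1, fun i => Nat.casesOn i w p, hn, by omega, rfl, ?_, ?_, hend⟩
    · rintro (_ | i) hi
      · simpa [hp0] using hv
      · exact hp i (by omega)
    · rintro j hj hj' (_ | k) hk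
      · have h1 := hpB j hj hj' 0 hm
        rw [hp0] at h1
        exact hE.trans h1 (hE.trans (hE.symm hsv) h)
      · exact hpB j hj hj' k (by omega)

/-- Segments with matching endpoints glue to a single sequence. -/
theorem exists_glue_segments {S : Type} {ξ : ℕ → ℕ} (hξ : StrictMono ξ) (hξ0 : ξ 0 = 0)
    (p : ℕ → ℕ → S) (hp : ∀ i, p i (ξ (i + 1) - ξ i) = p (i + 1) 0) :
    ∃ δ : ℕ → S, ∀ i k, ξ i ≤ k → k ≤ ξ (i + 1) → δ k = p i (k - ξ i) := by
  choose I hI1 hI2 using hξ.exists_mem_block hξ0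
  have key : ∀ i k, ξ i ≤ k → k < ξ (i + 1) → p (I k) (k - ξ (I k)) = p i (k - ξ i) := by
    intro i k h1 h2
    have ha : I k < i + 1 := hξ.lt_iff_lt.1 ((hI1 k).trans_lt h2)
    have hb : i < I k + 1 := hξ.lt_iff_lt.1 (h1.trans_lt (hI2 k))
    rw [show I k = i by omega]
  refine ⟨fun k => p (I k) (k - ξ (I k)), fun i k h1 h2 => ?_⟩
  rcases h2.eq_or_lt with rfl | h2
  · simpa only [hp, Nat.sub_self] using key (i + 1) _ le_rfl (hξ (Nat.lt_succ_self _))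
  · exact key i k h1 h2

/-- states related by a WEB have identical behaviors up to finite
stuttering. -/
theorem stmt8 {S Λ : Type} (M : TS S Λ) (B : S → S → Prop) (hB : isWEB M B)
    (s w : S) (hsw : B s w)
    (σ : ℕ → S) (hσ0 : σ 0 = s) (hσ : ∀ i : ℕ, M.tr (σ i) (σ (i + 1))) :
    ∃ (δ : ℕ → S), δ 0 = w ∧ (∀ j : ℕ, M.tr (δ j) (δ (j + 1))) ∧
      ∃ π ξ : ℕ → ℕ, StrictMono π ∧ StrictMono ξ ∧ π 0 = 0 ∧ ξ 0 = 0 ∧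
        ∀ i : ℕ, ∀ j : ℕ, π i ≤ j → j < π (i + 1) →
          ∀ k : ℕ, ξ i ≤ k → k < ξ (i + 1) → B (σ j) (δ k) := by
  choose N m p hN hm hp0 hp hpB hend using
    fun t : {x : ℕ × S // B (σ x.1) x.2} =>
      hB.exists_matching_block hσ t.1.1 t.1.2 t.2
  let seq : ℕ → {x : ℕ × S // B (σ x.1) x.2} := fun i =>
    Nat.rec ⟨(0, w), hσ0 ▸ hsw⟩ (fun _ t => ⟨(N t, p t (m t)), hend t⟩) i
  let ξ : ℕ → ℕ := fun i => ∑ j ∈ Finset.range i, m (seq j)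
  have hξs : ∀ i, ξ (i + 1) = ξ i + m (seq i) := fun i => Finset.sum_range_succ _ _
  have hξ0 : ξ 0 = 0 := rfl
  have hξ : StrictMono ξ := strictMono_nat_of_lt_succ fun i => by
    have := hm (seq i)
    rw [hξs]
    omega
  obtain ⟨δ, hδ⟩ := exists_glue_segments hξ hξ0 (fun i => p (seq i)) fun i => by
    rw [hξs, Nat.add_sub_cancel_left]
    exact (hp0 (seq (i + 1))).symm
  refine ⟨δ, (hδ 0 0 le_rfl (Nat.zero_le _)).trans (hp0 (seq 0)), ?_,
    fun i => (seq i).1.1, ξ, strictMono_nat_of_lt_succ fun i => hN (seq i), hξ, rfl, hξ0, ?_⟩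
  · intro j
    obtain ⟨i, h1, h2⟩ := hξ.exists_mem_block hξ0 j
    rw [hδ i j h1 h2.le, hδ i (j + 1) (by omega) h2, Nat.sub_add_comm h1]
    exact hp (seq i) _ (by have := hξs i; omega)
  · intro i j hj hj' k hk hk'
    rw [hδ i k hk hk'.le]
    exact hpB (seq i) j hj hj' _ (by have := hξs i; omega)
end

section
/- (Every observable behavior of the concrete system is allowed by the abstract system, up to finite stuttering.) Suppose M_C is a WEB refinement of M_A with respect to r, and suppose every state of M_A has at least one →_A-successor. Then for every fullpath σ : ℕ → S_C in M_C (i.e., σ(i) →_C σ(i+1) for all i ∈ ℕ) there exist a fullpath δ : ℕ → S_A in M_A with δ(0) = r(σ(0)) and δ(k) →_A δ(k+1) for all k ∈ ℕ, and strictly increasing functions π, ξ : ℕ → ℕ with π(0) = ξ(0) = 0, such that for every i ∈ ℕ, every j with π(i) ≤ j < π(i+1), and every k with ξ(i) ≤ k < ξ(i+1), we have L_A(r(σ(j))) = L_A(δ(k)). -/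
/-- Finite paths that fit end to end concatenate to an infinite sequence, in which the `i`-th
path, of length `b i + 1`, starts at position `ξ i`. -/
theorem exists_concat {α : Type} (R : α → α → Prop) (b : ℕ → ℕ) (p : ℕ → ℕ → α)
    (hstep : ∀ i t, t ≤ b i → R (p i t) (p i (t + 1)))
    (hglue : ∀ i, p i (b i + 1) = p (i + 1) 0) :
    ∃ (δ : ℕ → α) (ξ : ℕ → ℕ), ξ 0 = 0 ∧ (∀ i, ξ (i + 1) = ξ i + b i + 1) ∧
      (∀ k, R (δ k) (δ (k + 1))) ∧ ∀ i t, t ≤ b i → δ (ξ i + t) = p i t := by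
  obtain ⟨ξ, h0, hs⟩ : ∃ ξ : ℕ → ℕ, ξ 0 = 0 ∧ ∀ i, ξ (i + 1) = ξ i + b i + 1 :=
    ⟨fun i => Nat.rec 0 (fun i x => x + b i + 1) i, rfl, fun _ => rfl⟩
  have hmono : Monotone ξ := monotone_nat_of_le_succ fun i => by rw [hs]; omega
  have hex : ∀ k, ∃ i t, t ≤ b i ∧ k = ξ i + t := by
    intro k
    induction k with
    | zero => exact ⟨0, 0, Nat.zero_le _, by omega⟩
    | succ k ih =>
      obtain ⟨i, t, ht, rfl⟩ := ih
      rcases ht.lt_or_eq with h | h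
      · exact ⟨i, t + 1, h, by omega⟩
      · exact ⟨i + 1, 0, Nat.zero_le _, by rw [hs]; omega⟩
  choose I T hT hk using hex
  have hlt : ∀ i j t u, t ≤ b i → ξ i + t = ξ j + u → ¬ i < j := by
    intro i j t u ht h hij
    have := hmono (Nat.succ_le_of_lt hij)
    rw [Nat.succ_eq_add_one, hs] at this
    omega
  have hδ : ∀ i t, t ≤ b i → p (I (ξ i + t)) (T (ξ i + t)) = p i t := by
    intro i t ht
    have h := hk (ξ i + t)
    have hI : I (ξ i + t) = i := le_antisymm
      (not_lt.1 (hlt _ _ _ _ ht h)) (not_lt.1 (hlt _ _ _ _ (hT _) h.symm))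
    have hT' : T (ξ i + t) = t := by rw [hI] at h; omega
    rw [hI, hT']
  refine ⟨fun k => p (I k) (T k), ξ, h0, hs, fun k => ?_, hδ⟩
  have key : p (I (k + 1)) (T (k + 1)) = p (I k) (T k + 1) := by
    rcases (hT k).lt_or_eq with h | h
    · rw [← hδ (I k) (T k + 1) h, ← add_assoc, ← hk k]
    · rw [h, hglue, ← hδ (I k + 1) 0 (Nat.zero_le _), add_zero, hs, ← h, ← hk k]
  change R _ (p (I (k + 1)) (T (k + 1)))
  rw [key]
  exact hstep _ _ (hT k)

/-- From related states, a concrete fullpath and some abstract path run through nonempty finite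
segments with constant label and reach related states again. -/
theorem exists_matching_segment {SC SA Λ : Type} {MC : TS SC Λ} {MA : TS SA Λ} {r : SC → SA}
    {B : SC ⊕ SA → SC ⊕ SA → Prop} (hB : isWEB (duTS MC MA r) B)
    {σ : ℕ → SC} (hσ : ∀ i, MC.tr (σ i) (σ (i + 1)))
    (n : ℕ) (w : SA) (hw : B (Sum.inl (σ n)) (Sum.inr w)) :
    ∃ (a b : ℕ) (p : ℕ → SA), p 0 = w ∧ (∀ t ≤ b, MA.tr (p t) (p (t + 1))) ∧
      B (Sum.inl (σ (n + a + 1))) (Sum.inr (p (b + 1))) ∧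
      (∀ j ≤ a, MA.L (r (σ (n + j))) = MA.L w) ∧ ∀ t ≤ b, MA.L (p t) = MA.L w := by
  obtain ⟨-, hL, W, prec, hwf, rankt, rankl, hstep⟩ := hB
  have hlabel : ∀ n w, B (Sum.inl (σ n)) (Sum.inr w) → MA.L (r (σ n)) = MA.L w :=
    fun n w h => hL _ _ h
  induction hx : rankt (Sum.inl (σ n)) using hwf.induction generalizing n w with
  | _ x ih =>
  subst hx
  induction hm : rankl (Sum.inr w) (Sum.inl (σ n)) using Nat.strong_induction_on
    generalizing w with
  | _ m ihm =>
  subst hm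
  have hn := hlabel n w hw
  rcases hstep _ (Sum.inl (σ (n + 1))) _ hw (hσ n) with
    ⟨v | v, hv, hB⟩ | ⟨hB, hlt⟩ | ⟨v | v, hv, hB, hlt⟩
  · exact hv.elim
  · refine ⟨0, 0, fun t => if t = 0 then w else v, rfl, ?_, hB, ?_, ?_⟩
    · intro t ht
      obtain rfl : t = 0 := by omega
      exact hv
    · intro j hj
      obtain rfl : j = 0 := by omega
      exact hn
    · intro t ht
      simp [Nat.le_zero.1 ht]
  · obtain ⟨a, b, p, hp0, hp, hend, hc, ha⟩ := ih _ hlt (n + 1) w hB rfl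
    refine ⟨a + 1, b, p, hp0, hp, ?_, ?_, ha⟩
    · rwa [show n + (a + 1) + 1 = n + 1 + a + 1 by omega]
    · rintro (_ | j) hj
      · exact hn
      · rw [show n + (j + 1) = n + 1 + j by omega]
        exact hc j (by omega)
  · exact hv.elim
  · obtain ⟨a, b, p, hp0, hp, hend, hc, ha⟩ := ihm _ hlt v hB rfl
    have hvw : MA.L v = MA.L w := (hlabel n v hB).symm.trans hn
    refine ⟨a, b + 1, fun t => Nat.casesOn t w p, rfl, ?_, hend,
      fun j hj => (hc j hj).trans hvw, ?_⟩
    · rintro (_ | t) ht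
      · change MA.tr w (p 0)
        rw [hp0]
        exact hv
      · exact hp t (by omega)
    · rintro (_ | t) ht
      · rfl
      · exact (ha t (by omega)).trans hvw

/-- every observable behavior of the concrete system is allowed by
the abstract system, up to finite stuttering. -/
theorem stmt9 {SC SA Λ : Type} (MC : TS SC Λ) (MA : TS SA Λ) (r : SC → SA)
    (href : WEBrefines MC MA r)
    (hsucc : ∀ w : SA, ∃ v : SA, MA.tr w v)
    (σ : ℕ → SC) (hσ : ∀ i : ℕ, MC.tr (σ i) (σ (i + 1))) :
    ∃ (δ : ℕ → SA), δ 0 = r (σ 0) ∧ (∀ k : ℕ, MA.tr (δ k) (δ (k + 1))) ∧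
      ∃ π ξ : ℕ → ℕ, StrictMono π ∧ StrictMono ξ ∧ π 0 = 0 ∧ ξ 0 = 0 ∧
        ∀ i : ℕ, ∀ j : ℕ, π i ≤ j → j < π (i + 1) →
          ∀ k : ℕ, ξ i ≤ k → k < ξ (i + 1) → MA.L (r (σ j)) = MA.L (δ k) := by
  obtain ⟨B, hr, hB⟩ := href
  choose a b p hp0 hp hend hc ha using
    fun q : {q : ℕ × SA // B (Sum.inl (σ q.1)) (Sum.inr q.2)} =>
      exists_matching_segment hB hσ q.1.1 q.1.2 q.2
  let next : {q : ℕ × SA // B (Sum.inl (σ q.1)) (Sum.inr q.2)} →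
      {q : ℕ × SA // B (Sum.inl (σ q.1)) (Sum.inr q.2)} :=
    fun q => ⟨(q.1.1 + a q + 1, p q (b q + 1)), hend q⟩
  let q : ℕ → {q : ℕ × SA // B (Sum.inl (σ q.1)) (Sum.inr q.2)} :=
    fun i => next^[i] ⟨(0, r (σ 0)), hr (σ 0)⟩
  have hq : ∀ i, q (i + 1) = next (q i) := fun i => Function.iterate_succ_apply' _ _ _
  obtain ⟨δ, ξ, hξ0, hξ, hδ, hδp⟩ := exists_concat MA.tr (fun i => b (q i)) (fun i => p (q i))
    (fun i => hp (q i)) (fun i => by simp only [hq, hp0, next])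
  have hπ : ∀ i, (q (i + 1)).1.1 = (q i).1.1 + a (q i) + 1 := fun i => by rw [hq]
  refine ⟨δ, ?_, hδ, fun i => (q i).1.1, ξ, strictMono_nat_of_lt_succ fun i => ?_,
    strictMono_nat_of_lt_succ fun i => ?_, rfl, hξ0, fun i j hj hj' k hk hk' => ?_⟩
  · have h := hδp 0 0 (Nat.zero_le _)
    rw [hξ0, hp0] at h
    exact h
  · rw [hπ]; omega
  · rw [hξ]; omega
  · beta_reduce at hj hj'
    rw [hπ] at hj'
    rw [hξ] at hk'
    obtain ⟨j, rfl⟩ := Nat.exists_eq_add_of_le hj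
    obtain ⟨k, rfl⟩ := Nat.exists_eq_add_of_le hk
    rw [hδp i k (by omega), hc (q i) j (by omega), ha (q i) k (by omega)]
end

section
/- (The equivalence induced by the refinement map is a canonical witness.) Suppose the labeling function L_A is injective and M_C is a WEB refinement of M_A with respect to r, witnessed by some WEB B on the disjoint-union TS with s B r(s) for all s ∈ S_C. Let B_r := {(x, y) ∈ (S_C ⊎ S_A)² : ρ(x) = ρ(y)}. Then (i) B ⊆ B_r, and (ii) B_r is itself a WEB on the disjoint-union TS satisfying s B_r r(s) for all s ∈ S_C, i.e., B_r also witnesses that M_C is a WEB refinement of M_A with respect to r. -/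
theorem rel_inr_rho {SC SA : Type} {r : SC → SA} {B : SC ⊕ SA → SC ⊕ SA → Prop}
    (hB : Equivalence B) (hr : ∀ s : SC, B (Sum.inl s) (Sum.inr (r s))) (x : SC ⊕ SA) :
    B x (Sum.inr (rho r x)) := by
  cases x with
  | inl s => exact hr s
  | inr s => exact hB.refl _

/-- the equivalence induced by the refinement map is a canonical
witness: any WEB witnessing the refinement is contained in `B_r`, and `B_r`
itself witnesses the refinement. -/
theorem stmt10 {SC SA Λ : Type} (MC : TS SC Λ) (MA : TS SA Λ) (r : SC → SA)
    (hinj : Function.Injective MA.L)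
    (B : (SC ⊕ SA) → (SC ⊕ SA) → Prop)
    (hBr : ∀ s : SC, B (Sum.inl s) (Sum.inr (r s)))
    (hBweb : isWEB (duTS MC MA r) B) :
    (∀ x y, B x y → rho r x = rho r y) ∧
    ((∀ s : SC, rho r (Sum.inl s) = rho r (Sum.inr (r s))) ∧
      isWEB (duTS MC MA r) (fun x y => rho r x = rho r y)) := by
  have hsub : ∀ x y, B x y → rho r x = rho r y := fun x y h =>
    hinj (by simpa only [duTS_L] using hBweb.2.1 x y h)
  have hsup : ∀ x y, rho r x = rho r y → B x y := fun x y h =>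
    hBweb.1.trans (h ▸ rel_inr_rho hBweb.1 hBr x) (hBweb.1.symm (rel_inr_rho hBweb.1 hBr y))
  have heq : B = fun x y => rho r x = rho r y := by
    ext x y
    exact ⟨hsub x y, hsup x y⟩
  exact ⟨hsub, fun _ => rfl, heq ▸ hBweb⟩
end

section
/- (A refinement of a non-stuttering abstract system cannot stutter forever.) Suppose the labeling function L_A is injective, the abstract system never stutters, i.e., there is no w ∈ S_A with w →_A w, and M_C is a WEB refinement of M_A with respect to r. Then there is no infinite sequence σ : ℕ → S_C with σ(i) →_C σ(i+1) for all i ∈ ℕ and r(σ(i)) = r(σ(0)) for all i ∈ ℕ; in other words, along every fullpath of the concrete system the image under the refinement map eventually changes. -/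
/-- a refinement of a non-stuttering abstract system cannot
stutter forever. -/
theorem stmt11 {SC SA Λ : Type} (MC : TS SC Λ) (MA : TS SA Λ) (r : SC → SA)
    (hinj : Function.Injective MA.L)
    (hnostutter : ¬ ∃ w : SA, MA.tr w w)
    (href : WEBrefines MC MA r) :
    ¬ ∃ σ : ℕ → SC, (∀ i : ℕ, MC.tr (σ i) (σ (i + 1))) ∧
      (∀ i : ℕ, r (σ i) = r (σ 0)) := by
  rintro ⟨σ, hstep, hconst⟩
  obtain ⟨B, hBr, -, hlabel, W, prec, hwf, rankt, rankl, hB⟩ := href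
  have hB0 (i : ℕ) : B (Sum.inl (σ i)) (Sum.inr (r (σ 0))) := hconst i ▸ hBr (σ i)
  -- By label injectivity, a matching abstract step would be a stutter.
  have hnomatch (i : ℕ) (v : SC ⊕ SA) (hv : (duTS MC MA r).tr (Sum.inr (r (σ 0))) v) :
      ¬ B (Sum.inl (σ i)) v := by
    intro hBv
    cases v with
    | inl c => exact hv
    | inr a =>
      have ha : r (σ i) = a := hinj (hlabel _ _ hBv)
      rw [hconst i] at ha
      subst ha
      exact hnostutter ⟨_, hv⟩
  have hdesc (i : ℕ) : prec (rankt (Sum.inl (σ (i + 1)))) (rankt (Sum.inl (σ i))) := by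
    rcases hB _ (Sum.inl (σ (i + 1))) _ (hB0 i) (hstep i) with
      ⟨v, hv, hBv⟩ | ⟨-, h⟩ | ⟨v, hv, hBv, -⟩
    · exact (hnomatch (i + 1) v hv hBv).elim
    · exact h
    · exact (hnomatch i v hv hBv).elim
  obtain ⟨_, ⟨i, rfl⟩, hmin⟩ :=
    hwf.has_min (Set.range fun i => rankt (Sum.inl (σ i))) ⟨_, 0, rfl⟩
  exact hmin _ ⟨i + 1, rfl⟩ (hdesc i)
end
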